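/- Let f(𝐱) = F₁(𝐱') + ωF₂(𝐱') ∈ 𝒢𝒮¹(Ω_D). Then on Ω_D \ ℝ^{p+1} the following hold: (i) (D_𝐱 − D_ω) f(𝐱) = (1 − q) F₂(𝐱')/r, where D_ω f denotes (D_{𝐱_p} + ω∂_r) applied to the restriction of f to the slice through ω; (ii) Γ f(𝐱) = (q − 1) ω F₂(𝐱'), where Γ = −Σ_{p+1 ≤ i < j ≤ p+q} e_i e_j L_{ij} is the spherical Dirac operator on ℝ^q with angular momentum operators L_{ij} = x_i ∂_{x_j} − x_j ∂_{x_i}. -/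

import Mathlib

/-!
Common framework for generalized partial-slice monogenic functions
(Xu–Sabadini, "On the Fueter-Sce theorem for generalized partial-slice
monogenic functions").

The real Clifford algebra `ℝ_{p+q}` is formalized as the Mathlib Clifford
algebra of the negative-definite quadratic form on `ℝ^{p+q}`; since Mathlib
provides no canonical norm on it, all analytic statements are phrased for an
arbitrary normed real algebra `A` together with an `ℝ`-algebra isomorphism
`ξ : A ≃ₐ[ℝ] Cl (p+q)`.  A point of `ℝ^{p+q+1}` is a pair
`(𝐱_p, 𝐱_q) : (Fin (p+1) → ℝ) × EuclideanSpace ℝ (Fin q)`, and a point of a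
slice `ℝ^{p+2}` is a pair `(𝐱_p, r)`.
-/

noncomputable section

open Filter Topology MeasureTheory Metric
open scoped Nat RealInnerProductSpace

namespace GPS

/-- The negative definite quadratic form `-(x₁² + ⋯ + xₙ²)` on `ℝⁿ`. -/
def Qe (n : ℕ) : QuadraticForm ℝ (Fin n → ℝ) :=
  QuadraticMap.weightedSumSquares ℝ (fun _ : Fin n => (-1 : ℝ))

/-- The real Clifford algebra `ℝ_n`. -/
abbrev Cl (n : ℕ) : Type := CliffordAlgebra (Qe n)

/-- The generators `e_1, …, e_n` of `ℝ_n` (indexed by `Fin n`). -/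
def e (n : ℕ) (i : Fin n) : Cl n := CliffordAlgebra.ι (Qe n) (Pi.single i 1)

variable (p q : ℕ)

/-- `ℝ^{p+1}`, the "slice-axis" space. -/
abbrev Vp : Type := Fin (p + 1) → ℝ

/-- `ℝ^q`. -/
abbrev Vq : Type := EuclideanSpace ℝ (Fin q)

/-- `ℝ^{p+q+1} = ℝ^{p+1} ⊕ ℝ^q`. -/
abbrev V : Type := Vp p × Vq q

/-- `ℝ^{p+2}`, the parameter space `(𝐱_p, r)` of a slice. -/
abbrev Sl : Type := Vp p × ℝ

/-- The sphere `𝕊` of unit 1-vectors, described by their coordinate vectors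
`(x_{p+1}, …, x_{p+q}) ∈ ℝ^q` with `∑ x_i² = 1`. -/
def S : Set (Vq q) := {v | ∑ j, v j ^ 2 = 1}

/-- The point `𝐱_p + r ω` of `ℝ^{p+q+1}`. -/
def spt (v : Vq q) (z : Sl p) : V p q := (z.1, z.2 • v)

/-- The (parameterized) slice `Ω_ω` of a set `Ω ⊆ ℝ^{p+q+1}`. -/
def sliceSet (Ω : Set (V p q)) (v : Vq q) : Set (Sl p) := {z | spt p q v z ∈ Ω}

/-- `Ω₀* = {𝐱_p + 𝐱_q : 𝐱_p ∈ Ω₀, 𝐱_q ∈ ℝ^q}`. -/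
def star0 (Ω₀ : Set (Vp p)) : Set (V p q) := {z | z.1 ∈ Ω₀}

/-- The p-symmetric completion `Ω_D` of a set `D ⊆ ℝ^{p+2}`. -/
def completion (D : Set (Sl p)) : Set (V p q) :=
  {x | ∃ z ∈ D, ∃ v ∈ S q, x = spt p q v z}

/-- `D` is invariant under the reflection of the `(p+2)`-th variable. -/
def ReflInv (D : Set (Sl p)) : Prop := ∀ z ∈ D, ((z.1, -z.2) : Sl p) ∈ D

/-- A domain: a nonempty open connected set. -/
def IsDomain {E : Type*} [TopologicalSpace E] (s : Set E) : Prop :=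
  IsOpen s ∧ IsConnected s

/-- A slice domain. -/
def IsSliceDomain (Ω : Set (V p q)) : Prop :=
  IsDomain Ω ∧ (∃ x : Vp p, ((x, 0) : V p q) ∈ Ω) ∧
    ∀ v ∈ S q, IsDomain (sliceSet p q Ω v)

/-- Partial symmetry with respect to `ℝ^{p+1}`. -/
def IsPSymmetric (Ω : Set (V p q)) : Prop :=
  ∀ (x : Vp p) (r : ℝ), ∀ v ∈ S q, ∀ w ∈ S q,
    ((x, r • v) : V p q) ∈ Ω → ((x, r • w) : V p q) ∈ Ω

/-- A `d`-dimensional smooth submanifold of a real normed space. -/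
def IsSmoothSubmanifoldDim {E : Type*} [NormedAddCommGroup E] [NormedSpace ℝ E]
    (d : ℕ) (M : Set E) : Prop :=
  ∀ x ∈ M, ∃ U : Set E, IsOpen U ∧ x ∈ U ∧
    ∃ (ψ : (Fin d → ℝ) → E) (W : Set (Fin d → ℝ)), IsOpen W ∧
      ContDiffOn ℝ (⊤ : ℕ∞) ψ W ∧ Set.InjOn ψ W ∧
      (∀ y ∈ W, Function.Injective (fderivWithin ℝ ψ W y)) ∧
      M ∩ U = ψ '' W

variable {A : Type*} [NormedRing A] [NormedAlgebra ℝ A] (ξ : A ≃ₐ[ℝ] Cl (p + q))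

/-- The generators `e_1, …, e_{p+q}` inside `A`. -/
def gen (i : Fin (p + q)) : A := ξ.symm (e (p + q) i)

/-- The generators `e_{p+1}, …, e_{p+q}` (the "q-part"). -/
def eQ (j : Fin q) : A := gen p q ξ ⟨p + (j : ℕ), by have := j.isLt; omega⟩

/-- The generators `e_1, …, e_p` (the "p-part", without `e_0 = 1`). -/
def eP (i : Fin p) : A := gen p q ξ ⟨(i : ℕ), by have := i.isLt; omega⟩

/-- `e_0 = 1, e_1, …, e_p`: the paravector basis of `ℝ^{p+1}` inside `A`. -/
def εp (i : Fin (p + 1)) : A :=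
  if h : (i : ℕ) = 0 then 1 else gen p q ξ ⟨(i : ℕ) - 1, by have := i.isLt; omega⟩

/-- The 1-vector `∑ x_i e_{p+i} ∈ A` corresponding to `𝐱_q ∈ ℝ^q`;
for a unit `v` this is the imaginary unit `ω ∈ 𝕊`. -/
def ωCl (v : Vq q) : A := ∑ j, v j • eQ p q ξ j

/-- The paravector `x_0 + x_1 e_1 + ⋯ + x_p e_p ∈ A` of `𝐱_p ∈ ℝ^{p+1}`. -/
def clP (x : Vp p) : A := ∑ i, x i • εp p q ξ i

/-- The paravector of `𝐱 ∈ ℝ^{p+q+1}` in `A`. -/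
def toCl (z : V p q) : A := clP p q ξ z.1 + ωCl p q ξ z.2

section SliceOperators

variable {F' : Type*} [NormedAddCommGroup F'] [NormedSpace ℝ F']

/-- `∂_{x_i}` on functions on `ℝ^{p+2}`. -/
def pdSl (i : Fin (p + 1)) (F : Sl p → F') : Sl p → F' :=
  fun z => fderiv ℝ F z (Pi.single i 1, 0)

/-- `∂_r` on functions on `ℝ^{p+2}`. -/
def pdr (F : Sl p → F') : Sl p → F' := fun z => fderiv ℝ F z (0, 1)

/-- `∂_{x_i}` (first factor) on functions on `ℝ^{p+q+1}`. -/
def pdV1 (i : Fin (p + 1)) (f : V p q → F') : V p q → F' :=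
  fun z => fderiv ℝ f z ((Pi.single i 1 : Vp p), 0)

/-- `∂_{x_{p+j}}` (second factor) on functions on `ℝ^{p+q+1}`. -/
def pdV2 (j : Fin q) (f : V p q → F') : V p q → F' :=
  fun z => fderiv ℝ f z (0, EuclideanSpace.single j 1)

/-- `∂_{x_i}` on functions on `ℝ^{p+1}`. -/
def pdP (i : Fin (p + 1)) (g : Vp p → F') : Vp p → F' :=
  fun x => fderiv ℝ g x (Pi.single i 1)

/-- The Laplacian `Δ_{𝐱'} = Δ_{𝐱_p} + ∂_r²` on `ℝ^{p+2}`. -/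
def LapSl (F : Sl p → F') : Sl p → F' :=
  fun z => ∑ i, pdSl p (i := i) (pdSl p i F) z + pdr p (pdr p F) z

/-- The Laplacian `Δ_𝐱` on `ℝ^{p+q+1}`. -/
def LapV (f : V p q → F') : V p q → F' :=
  fun z => ∑ i, pdV1 p q i (pdV1 p q i f) z + ∑ j, pdV2 p q j (pdV2 p q j f) z

/-- The Laplacian `Δ_{𝐱_p}` on `ℝ^{p+1}`. -/
def LapP (g : Vp p → F') : Vp p → F' :=
  fun x => ∑ i, pdP p i (pdP p i g) x

end SliceOperators

/-- The generalized Cauchy–Riemann operator `D_{𝐱_p} = ∑_{i=0}^p e_i ∂_{x_i}`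
on slice functions. -/
def DP (F : Sl p → A) : Sl p → A :=
  fun z => ∑ i, εp p q ξ i * pdSl p i F z

/-- The conjugated operator `D̄_{𝐱_p} = ∂_{x_0} - ∑_{i=1}^p e_i ∂_{x_i}`. -/
def DPbar (F : Sl p → A) : Sl p → A :=
  fun z => pdSl p 0 F z - ∑ i : Fin p, eP p q ξ i * pdSl p i.succ F z

/-- The generalized Cauchy–Riemann (Dirac) operator `D_𝐱` on `ℝ^{p+q+1}`. -/
def DV (f : V p q → A) : V p q → A :=
  fun z => ∑ i, εp p q ξ i * pdV1 p q i f z + ∑ j, eQ p q ξ j * pdV2 p q j f z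

/-- `D_{𝐱_p} = ∑_{i=0}^p e_i ∂_{x_i}` on functions on `ℝ^{p+1}`. -/
def DPfun (g : Vp p → A) : Vp p → A :=
  fun x => ∑ i, εp p q ξ i * pdP p i g x

/-- The slice operator `D_ω = D_{𝐱_p} + ω ∂_r`, expressed on `ℝ^{p+q+1} ∖ ℝ^{p+1}`
(at `𝐱_q = 0` the radial part is junk `0`). -/
def Dslice (f : V p q → A) : V p q → A :=
  fun z => ∑ i, εp p q ξ i * pdV1 p q i f z
    + ωCl p q ξ (‖z.2‖⁻¹ • z.2) * fderiv ℝ f z (0, ‖z.2‖⁻¹ • z.2)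

/-- The spherical Dirac operator `Γ = -∑_{i<j} e_i e_j L_{ij}` on the `ℝ^q` variables. -/
def sphericalDirac (f : V p q → A) : V p q → A :=
  fun z => - ∑ i : Fin q, ∑ j : Fin q,
    if (i : ℕ) < (j : ℕ) then
      eQ p q ξ i * eQ p q ξ j *
        (z.2 i • pdV2 p q j f z - z.2 j • pdV2 p q i f z)
    else 0

/-- `f` is left generalized partial-slice monogenic of type `(p,q)` on `Ω`. -/
def GSMOn (Ω : Set (V p q)) (f : V p q → A) : Prop :=
  ∀ v ∈ S q,
    ContDiffOn ℝ 1 (fun z => f (spt p q v z)) (sliceSet p q Ω v) ∧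
    ∀ z ∈ sliceSet p q Ω v,
      DP p q ξ (fun w => f (spt p q v w)) z
        + ωCl p q ξ v * pdr p (fun w => f (spt p q v w)) z = 0

/-- `f` is (left) monogenic on `Ω`. -/
def MonogenicOn (Ω : Set (V p q)) (f : V p q → A) : Prop :=
  ContDiffOn ℝ 1 f Ω ∧ ∀ z ∈ Ω, DV p q ξ f z = 0

/-- `f` is the generalized partial-slice function on `Ω_D` with components `F1, F2`
(an even–odd pair in the last variable). -/
def IsGPSlice (D : Set (Sl p)) (f : V p q → A) (F1 F2 : Sl p → A) : Prop :=
  (∀ z ∈ D, F1 (z.1, -z.2) = F1 z ∧ F2 (z.1, -z.2) = -F2 z) ∧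
  ∀ z ∈ D, ∀ v ∈ S q, f (spt p q v z) = F1 z + ωCl p q ξ v * F2 z

/-- The generalized Cauchy–Riemann system (2.6) for the pair `(F1, F2)`. -/
def CRSystem (D : Set (Sl p)) (F1 F2 : Sl p → A) : Prop :=
  ∀ z ∈ D, DP p q ξ F1 z - pdr p F2 z = 0 ∧ DPbar p q ξ F2 z + pdr p F1 z = 0

/-- `f ∈ 𝒢𝒮ℛ(Ω_D)` with the given components. -/
def GSROnWith (D : Set (Sl p)) (f : V p q → A) (F1 F2 : Sl p → A) : Prop :=
  IsGPSlice p q ξ D f F1 F2 ∧ ContDiffOn ℝ 1 F1 D ∧ ContDiffOn ℝ 1 F2 D ∧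
    CRSystem p q ξ D F1 F2

/-- `f ∈ 𝒢𝒮ℛ(Ω_D)`. -/
def GSROn (D : Set (Sl p)) (f : V p q → A) : Prop :=
  ∃ F1 F2, GSROnWith p q ξ D f F1 F2

/-- Iterates `((1/r) ∂_r)^k F`. -/
def AIter (F : Sl p → A) : ℕ → Sl p → A
  | 0 => F
  | k + 1 => fun z => z.2⁻¹ • pdr p (AIter F k) z

/-- Iterates `(∂_r (1/r))^k F`. -/
def BIter (F : Sl p → A) : ℕ → Sl p → A
  | 0 => F
  | k + 1 => fun z => fderiv ℝ (fun w : Sl p => w.2⁻¹ • BIter F k w) z (0, 1)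

/-- `C_q(k) = (q-1)(q-3)⋯(q-2k+1)`. -/
def Cq (k : ℕ) : ℝ := ∏ j ∈ Finset.range k, ((q : ℝ) - (2 * (j : ℝ) + 1))

/-- The Fueter–Sce map `τ_q = (1/(q-1)!!) Δ^{(q-1)/2}` (for odd `q`). -/
def tauq (f : V p q → A) : V p q → A :=
  fun z => (((q - 1)‼ : ℝ))⁻¹ • (LapV p q)^[(q - 1) / 2] f z

/-- `(𝐱_q D_{𝐱_p})^k`, for a fixed Clifford element `u` in place of `𝐱_q`. -/
def uDpow (u : A) : ℕ → (Vp p → A) → Vp p → A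
  | 0 => fun g => g
  | k + 1 => fun g x => u * DPfun p q ξ (uDpow u k g) x

/-- The `k`-th term of the slice Cauchy–Kovalevskaya extension series. -/
def ckTerm (f₀ : Vp p → A) (k : ℕ) (z : V p q) : A :=
  ((k ! : ℝ))⁻¹ • uDpow p q ξ (ωCl p q ξ z.2) k f₀ z.1

/-- The slice Cauchy–Kovalevskaya extension `CK[f₀]`. -/
def CKext (f₀ : Vp p → A) (z : V p q) : A := ∑' k, ckTerm p q ξ f₀ k z

/-- The `k`-th term of the CK-extension for a fixed direction `w`. -/
def ckDirTerm (w : Vq q) (f₀ : Vp p → A) (k : ℕ) (z : V p q) : A :=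
  ((⟪w, z.2⟫) ^ k / (k ! : ℝ)) • uDpow p q ξ (ωCl p q ξ w) k f₀ z.1

/-- The CK-extension for a fixed direction `w ∈ 𝕊`. -/
def CKdir (w : Vq q) (f₀ : Vp p → A) (z : V p q) : A :=
  ∑' k, ckDirTerm p q ξ w f₀ k z

/-- The coefficients of the generalized CK-extension:
`f_{2k} = (Γ(q/2) / (2^{2k} k! Γ(k+q/2))) Δ^k f₀` and
`f_{2k+1} = (Γ(q/2) / (2^{2k+1} k! Γ(k+q/2+1))) D Δ^k f₀`. -/
def gckCoeff (f₀ : Vp p → A) (k : ℕ) : Vp p → A :=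
  if k % 2 = 0 then
    fun x => (Real.Gamma ((q : ℝ) / 2) /
        (2 ^ k * ((k / 2)! : ℝ) * Real.Gamma (((k / 2 : ℕ) : ℝ) + (q : ℝ) / 2))) •
      (LapP p)^[k / 2] f₀ x
  else
    fun x => (Real.Gamma ((q : ℝ) / 2) /
        (2 ^ k * ((k / 2)! : ℝ) * Real.Gamma (((k / 2 : ℕ) : ℝ) + (q : ℝ) / 2 + 1))) •
      DPfun p q ξ ((LapP p)^[k / 2] f₀) x

/-- The `k`-th term `𝐱_q^k f_k(𝐱_p)` of the generalized CK-extension series. -/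
def gckTerm (f₀ : Vp p → A) (k : ℕ) (z : V p q) : A :=
  (ωCl p q ξ z.2) ^ k * gckCoeff p q ξ f₀ k z.1

/-- The generalized CK-extension `GCK[f₀]`. -/
def GCKext (f₀ : Vp p → A) (z : V p q) : A := ∑' k, gckTerm p q ξ f₀ k z

/-- The Radon transform `R[f](𝐱_p, r, ω) = ∫_{⟨𝐱_q,ω⟩=r} f(𝐱_p, 𝐱_q) dσ(𝐱_q)`. -/
def radon (f : V p q → A) (x : Vp p) (r : ℝ) (w : Vq q) : A :=
  ∫ u : ((Submodule.span ℝ {w})ᗮ : Submodule ℝ (Vq q)),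
    f (x, r • w + (u : Vq q))

/-- The (suitably normalized) surface measure on the unit sphere of `ℝ^q`. -/
def sphMeasure : Measure (sphere (0 : Vq q) 1) := volume.toSphere

/-- The dual Radon transform
`Ř[f](𝐱_p, 𝐱_q) = (1/A_q) ∫_𝕊 f(𝐱_p, ⟨𝐱_q, η⟩ η) dS(η)` (a spherical average). -/
def dualRadon (f : V p q → A) (z : V p q) : A :=
  ⨍ w : sphere (0 : Vq q) 1,
    f (z.1, (⟪((w : Vq q)), z.2⟫) • (w : Vq q)) ∂(sphMeasure q)

end GPS

namespace GPS

variable (p q : ℕ) {A : Type*} [NormedRing A] [NormedAlgebra ℝ A] (ξ : A ≃ₐ[ℝ] Cl (p + q))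

lemma Qe_single (n : ℕ) (i : Fin n) : Qe n (Pi.single i 1) = -1 := by
  simp [Qe, QuadraticMap.weightedSumSquares_apply, Pi.single_apply]

lemma polar_Qe_single (n : ℕ) {i j : Fin n} (h : i ≠ j) :
    QuadraticMap.polar (Qe n) (Pi.single i 1) (Pi.single j 1) = 0 := by
  rw [QuadraticMap.polar, Qe_single, Qe_single]
  have hne (k : Fin n) : (Pi.single i 1 + Pi.single j 1 : Fin n → ℝ) k *
      (Pi.single i 1 + Pi.single j 1 : Fin n → ℝ) k
      = (if k = i then 1 else 0) + (if k = j then 1 else 0) := by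
    simp only [Pi.add_apply, Pi.single_apply]
    split_ifs <;> simp_all
  simp only [Qe, QuadraticMap.weightedSumSquares_apply, hne]
  simp [Finset.sum_add_distrib]

lemma eQ_mul_self (i : Fin q) : eQ p q ξ i * eQ p q ξ i = -1 := by
  rw [eQ, gen, ← map_mul, e, CliffordAlgebra.ι_sq_scalar, Qe_single]
  simp

lemma eQ_mul_eQ_add_swap {i j : Fin q} (h : i ≠ j) :
    eQ p q ξ i * eQ p q ξ j + eQ p q ξ j * eQ p q ξ i = 0 := by
  simp only [eQ, gen]
  rw [← map_mul, ← map_mul, ← map_add, e, e, CliffordAlgebra.ι_mul_ι_add_swap,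
    polar_Qe_single]
  · simp
  · intro h'
    apply h
    simp only [Fin.mk.injEq] at h'
    exact Fin.ext (by omega)

/-- The embedding `ωCl` of `ℝ^q` as a continuous linear map. -/
def ωClL : Vq q →L[ℝ] A :=
  ∑ j, (EuclideanSpace.proj j : Vq q →L[ℝ] ℝ).smulRight (eQ p q ξ j)

lemma ωClL_apply (v : Vq q) : ωClL p q ξ v = ωCl p q ξ v := by
  simp [ωClL, ωCl]

lemma ωCl_smul (c : ℝ) (v : Vq q) : ωCl p q ξ (c • v) = c • ωCl p q ξ v := by
  simp only [← ωClL_apply, map_smul]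

lemma ωCl_single (j : Fin q) : ωCl p q ξ (EuclideanSpace.single j 1) = eQ p q ξ j := by
  simp [ωCl]

lemma ωCl_mul_self {v : Vq q} (hv : v ∈ S q) : ωCl p q ξ v * ωCl p q ξ v = -1 := by
  have hexp : ωCl p q ξ v * ωCl p q ξ v
      = ∑ i, ∑ j, (v i * v j) • (eQ p q ξ i * eQ p q ξ j) := by
    simp only [ωCl, Finset.sum_mul_sum, smul_mul_smul_comm]
  have hswap : ωCl p q ξ v * ωCl p q ξ v
      = ∑ i, ∑ j, (v i * v j) • (eQ p q ξ j * eQ p q ξ i) := by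
    rw [hexp, Finset.sum_comm]
    exact Finset.sum_congr rfl fun i _ => Finset.sum_congr rfl fun j _ => by rw [mul_comm (v j)]
  have hanti (i j : Fin q) : (v i * v j) • (eQ p q ξ i * eQ p q ξ j)
      + (v i * v j) • (eQ p q ξ j * eQ p q ξ i)
      = if i = j then (v i ^ 2) • (-2 : A) else 0 := by
    split_ifs with h
    · subst h
      rw [eQ_mul_self, ← smul_add, pow_two]
      norm_num
    · rw [← smul_add, eQ_mul_eQ_add_swap p q ξ h, smul_zero]
  have htwo : (2 : ℝ) • (ωCl p q ξ v * ωCl p q ξ v) = (2 : ℝ) • (-1 : A) := by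
    rw [two_smul]
    nth_rewrite 1 [hexp]
    rw [hswap]
    simp only [← Finset.sum_add_distrib, hanti, Finset.sum_ite_eq, Finset.mem_univ, if_true]
    rw [← Finset.sum_smul, show ∑ i, v i ^ 2 = 1 from hv, one_smul, two_smul]
    norm_num
  exact smul_right_injective A (two_ne_zero (α := ℝ)) htwo

lemma norm_eq_one_of_mem_S {v : Vq q} (hv : v ∈ S q) : ‖v‖ = 1 := by
  rw [EuclideanSpace.norm_eq]
  simp [show ∑ i, v i ^ 2 = 1 from hv]

variable {p q}

/-- The sum `∑_{i<j} (a_i + a_j)` counts each term `q - 1` times. -/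
lemma sum_lt_add {E : Type*} [AddCommGroup E] [Module ℝ E] (a : Fin q → E) :
    ∑ i : Fin q, ∑ j : Fin q, (if (i : ℕ) < (j : ℕ) then a i + a j else 0)
      = ((q : ℝ) - 1) • ∑ i, a i := by
  have hsplit (i j : Fin q) : (if (i : ℕ) < (j : ℕ) then a i + a j else 0)
      = (if (i : ℕ) < (j : ℕ) then a i else 0) + (if (i : ℕ) < (j : ℕ) then a j else 0) := by
    split_ifs <;> simp
  simp only [hsplit, Finset.sum_add_distrib]
  rw [Finset.sum_comm (f := fun i j : Fin q => if (i : ℕ) < (j : ℕ) then a j else 0),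
    ← Finset.sum_add_distrib, Finset.smul_sum]
  refine Finset.sum_congr rfl fun i _ => ?_
  have hne (j : Fin q) : (if (i : ℕ) < (j : ℕ) then a i else 0)
      + (if (j : ℕ) < (i : ℕ) then a i else 0) = a i - if j = i then a i else 0 := by
    rcases lt_trichotomy (i : ℕ) (j : ℕ) with h | h | h
    · simp [h, h.not_gt, show j ≠ i by rintro rfl; omega]
    · simp [Fin.ext h]
    · simp [h, h.not_gt, show j ≠ i by rintro rfl; omega]
  rw [← Finset.sum_add_distrib]
  simp only [hne, Finset.sum_sub_distrib, Finset.sum_ite_eq', Finset.mem_univ, if_true]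
  simp [sub_smul, Nat.cast_smul_eq_nsmul]

lemma eQ_mul_eQ_mul_sub {i j : Fin q} (h : i ≠ j) (a b : ℝ) :
    eQ p q ξ i * eQ p q ξ j * (a • eQ p q ξ j - b • eQ p q ξ i)
      = -(a • eQ p q ξ i + b • eQ p q ξ j) := by
  have hswap : eQ p q ξ i * eQ p q ξ j = -(eQ p q ξ j * eQ p q ξ i) :=
    eq_neg_of_add_eq_zero_left (eQ_mul_eQ_add_swap p q ξ h)
  rw [mul_sub, mul_smul_comm, mul_smul_comm, mul_assoc, eQ_mul_self, hswap, neg_mul, mul_assoc,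
    eQ_mul_self]
  simp [sub_eq_add_neg, add_comm]

/-- The derivative in the direction `(0, h)` of a generalized partial-slice function at
`𝐱_p + r v` is a radial part `⟪v, h⟫ G` plus the spherical part `r⁻¹ h F₂`. -/
lemma exists_fderiv_eq {D : Set (Sl p)} (hD : IsOpen D)
    {f : V p q → A} {F1 F2 : Sl p → A}
    (hf : ∀ z ∈ D, ∀ v ∈ S q, f (spt p q v z) = F1 z + ωCl p q ξ v * F2 z)
    (hF1 : ContDiffOn ℝ 1 F1 D) (hF2 : ContDiffOn ℝ 1 F2 D)
    {z : Sl p} (hz : z ∈ D) (hr : z.2 ≠ 0) {v : Vq q} (hv : v ∈ S q) :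
    ∃ G : A, ∀ h : Vq q, fderiv ℝ f (spt p q v z) (0, h)
      = ⟪v, h⟫ • G + z.2⁻¹ • (ωCl p q ξ h * F2 z) := by
  obtain ⟨x, r⟩ := z
  simp only at hr
  have hnv := norm_eq_one_of_mem_S q hv
  set σ : ℝ := r / |r| with hσ
  have hr' : |r| ≠ 0 := abs_ne_zero.mpr hr
  have hσr : σ * |r| = r := div_mul_cancel₀ _ hr'
  have hσσ : σ * σ = 1 := by
    rw [hσ, div_mul_div_comm, abs_mul_abs_self, div_self (mul_ne_zero hr hr)]
  have hσ0 : σ ≠ 0 := div_ne_zero hr hr'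
  have hrv : r • v ≠ 0 := smul_ne_zero hr (norm_ne_zero_iff.mp (by rw [hnv]; exact one_ne_zero))
  -- the signed radius
  set N : V p q → ℝ := fun y => σ * ‖y.2‖ with hN
  have hNp : N (x, r • v) = r := by simp [hN, norm_smul, hnv, hσr]
  have hNd : HasFDerivAt N ((innerSL ℝ v).comp (ContinuousLinearMap.snd ℝ (Vp p) (Vq q)))
      (x, r • v) := by
    have hpos : ‖(r • v : Vq q)‖ ^ 2 ≠ 0 := pow_ne_zero 2 (norm_ne_zero_iff.mpr hrv)
    have hsqrt := ((hasFDerivAt_snd (𝕜 := ℝ) (E := Vp p) (F := Vq q)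
      (p := (x, r • v))).norm_sq.sqrt hpos).const_mul σ
    simp only [Real.sqrt_sq (norm_nonneg _)] at hsqrt
    refine hsqrt.congr_fderiv (ContinuousLinearMap.ext fun y => ?_)
    have hfac : σ * (|r|⁻¹ * r) = 1 := by rw [mul_comm |r|⁻¹, ← div_eq_mul_inv, hσσ]
    simp only [norm_smul, hnv, Real.norm_eq_abs, smul_apply,
      ContinuousLinearMap.comp_apply, innerSL_apply_apply, inner_smul_left, smul_eq_mul,
      ContinuousLinearMap.coe_snd', nsmul_eq_mul]
    simp
    linear_combination ⟪v, y.2⟫ * hfac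
  have hev : f =ᶠ[𝓝 ((x, r • v) : V p q)] fun y =>
      F1 (y.1, N y) + (N y)⁻¹ • (ωClL p q ξ y.2 * F2 (y.1, N y)) := by
    have hcont : ContinuousAt (fun y : V p q => ((y.1, N y) : Sl p)) (x, r • v) := by
      fun_prop
    have h1 : ∀ᶠ y in 𝓝 ((x, r • v) : V p q), ((y.1, N y) : Sl p) ∈ D :=
      hcont.eventually (by simp only [hNp]; exact hD.mem_nhds hz)
    have h2 : ∀ᶠ y in 𝓝 ((x, r • v) : V p q), y.2 ≠ 0 :=
      continuous_snd.continuousAt.eventually_ne hrv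
    filter_upwards [h1, h2] with y hy hy0
    have hny : ‖y.2‖ ≠ 0 := norm_ne_zero_iff.mpr hy0
    have hN0 : N y ≠ 0 := mul_ne_zero hσ0 hny
    have hmem : (N y)⁻¹ • y.2 ∈ S q := by
      have h3 : ∑ j, y.2 j ^ 2 = N y ^ 2 := by
        rw [hN, mul_pow, pow_two σ, hσσ, one_mul, EuclideanSpace.real_norm_sq_eq]
      simp only [S, Set.mem_ofPred_eq, PiLp.smul_apply, smul_eq_mul, mul_pow]
      rw [← Finset.mul_sum, h3, ← mul_pow, inv_mul_cancel₀ hN0, one_pow]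
    have := hf _ hy _ hmem
    simp only [spt, smul_smul, mul_inv_cancel₀ hN0, one_smul] at this
    rw [this, ωCl_smul, smul_mul_assoc, ωClL_apply]
  have hd1 := ((hF1.contDiffAt (hD.mem_nhds hz)).differentiableAt one_ne_zero).hasFDerivAt
  have hd2 := ((hF2.contDiffAt (hD.mem_nhds hz)).differentiableAt one_ne_zero).hasFDerivAt
  have hg : HasFDerivAt (fun y : V p q => ((y.1, N y) : Sl p)) _ (x, r • v) :=
    hasFDerivAt_fst.prodMk hNd
  rw [← hNp] at hd1 hd2
  have hu : HasFDerivAt (fun y : V p q => ωClL p q ξ y.2)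
      ((ωClL p q ξ).comp (ContinuousLinearMap.snd ℝ (Vp p) (Vq q))) (x, r • v) :=
    ((ωClL p q ξ).comp (ContinuousLinearMap.snd ℝ (Vp p) (Vq q))).hasFDerivAt
  have hinv := (hasDerivAt_inv (by rw [hNp]; exact hr :
    N (x, r • v) ≠ 0)).comp_hasFDerivAt (x, r • v) hNd
  have htot := (HasFDerivAt.comp (x, r • v) hd1 hg).add
    (hinv.smul (hu.mul' (HasFDerivAt.comp (x, r • v) hd2 hg)))
  have hfd := (htot.congr_of_eventuallyEq hev).fderiv
  refine ⟨fderiv ℝ F1 (x, r) (0, 1) + ωCl p q ξ v * fderiv ℝ F2 (x, r) (0, 1)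
    - r⁻¹ • (ωCl p q ξ v * F2 (x, r)), fun h => ?_⟩
  have hlin (F : Sl p → A) (a : ℝ) :
      fderiv ℝ F (x, r) (0, a) = a • fderiv ℝ F (x, r) (0, 1) := by
    rw [← map_smul]; simp
  rw [spt, hfd]
  simp [hNp, ωClL_apply]
  rw [hlin F1, hlin F2, ωCl_smul, smul_mul_assoc, mul_smul_comm]
  match_scalars <;> field_simp

end GPS

open GPS

/-- Proposition 3.1.  For `f = F₁ + ωF₂ ∈ 𝒢𝒮¹(Ω_D)`, on `Ω_D ∖ ℝ^{p+1}`: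
(i) `(D_𝐱 − D_ω) f = (1 − q) F₂/r`;
(ii) `Γ f = (q − 1) ω F₂`, where `Γ` is the spherical Dirac operator on `ℝ^q`. -/
theorem dirac_minus_slice_dirac
    (p q : ℕ) (hq : 1 ≤ q) {A : Type*} [NormedRing A] [NormedAlgebra ℝ A]
    (ξ : A ≃ₐ[ℝ] Cl (p + q))
    (D : Set (Sl p)) (hD : IsDomain D) (hrefl : ReflInv p D)
    (f : V p q → A) (F1 F2 : Sl p → A)
    (hgs : IsGPSlice p q ξ D f F1 F2)
    (hF1 : ContDiffOn ℝ 1 F1 D) (hF2 : ContDiffOn ℝ 1 F2 D) :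
    ∀ z ∈ D, z.2 ≠ 0 → ∀ v ∈ S q,
      DV p q ξ f (spt p q v z) - Dslice p q ξ f (spt p q v z)
          = ((1 - (q : ℝ)) / z.2) • F2 z ∧
      sphericalDirac p q ξ f (spt p q v z) = ((q : ℝ) - 1) • (ωCl p q ξ v * F2 z) := by
  intro z hz hr v hv
  obtain ⟨G, hG⟩ := exists_fderiv_eq ξ hD.1 hgs.2 hF1 hF2 hz hr hv
  have hsingle (j : Fin q) : fderiv ℝ f (spt p q v z) (0, EuclideanSpace.single j 1)
      = v j • G + z.2⁻¹ • (eQ p q ξ j * F2 z) := by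
    rw [hG, ωCl_single]
    simp [EuclideanSpace.inner_single_right]
  have hωω := ωCl_mul_self p q ξ hv
  constructor
  · have hnv := norm_eq_one_of_mem_S q hv
    obtain ⟨c, hc, hcc⟩ : ∃ c : ℝ, ‖z.2 • v‖⁻¹ • z.2 • v = c • v ∧ c * c = 1 := by
      refine ⟨|z.2|⁻¹ * z.2, by simp [norm_smul, hnv, smul_smul], ?_⟩
      rw [mul_mul_mul_comm, ← mul_inv, abs_mul_abs_self, inv_mul_cancel₀ (mul_ne_zero hr hr)]
    have hrad : fderiv ℝ f (spt p q v z) (0, v) = G + z.2⁻¹ • (ωCl p q ξ v * F2 z) := by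
      rw [hG, real_inner_self_eq_norm_sq, hnv]
      simp
    have hslice : ωCl p q ξ (c • v) * fderiv ℝ f (spt p q v z) (0, c • v)
        = ωCl p q ξ v * G - z.2⁻¹ • F2 z := by
      rw [show ((0, c • v) : V p q) = c • (0, v) by simp, map_smul, ωCl_smul,
        smul_mul_smul_comm, hcc, one_smul, hrad, mul_add, mul_smul_comm, ← mul_assoc, hωω]
      simp [sub_eq_add_neg]
    have hdirac : ∑ j, eQ p q ξ j * pdV2 p q j f (spt p q v z)
        = ωCl p q ξ v * G - ((q : ℝ) * z.2⁻¹) • F2 z := by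
      simp only [pdV2, hsingle, mul_add, mul_smul_comm, ← mul_assoc, eQ_mul_self,
        Finset.sum_add_distrib, ωCl, Finset.sum_mul, smul_mul_assoc]
      simp [sub_eq_add_neg, mul_smul, Nat.cast_smul_eq_nsmul]
    simp only [DV, Dslice, hdirac]
    simp only [spt] at hslice ⊢
    rw [hc, hslice, sub_div, sub_smul, div_eq_mul_inv, div_eq_mul_inv, one_mul]
    abel
  · have hterm (i j : Fin q) : (if (i : ℕ) < (j : ℕ) then
        eQ p q ξ i * eQ p q ξ j * ((spt p q v z).2 i • pdV2 p q j f (spt p q v z)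
          - (spt p q v z).2 j • pdV2 p q i f (spt p q v z)) else 0)
        = -((if (i : ℕ) < (j : ℕ) then v i • eQ p q ξ i + v j • eQ p q ξ j else 0) * F2 z) := by
      split_ifs with h
      · have hL : (spt p q v z).2 i • pdV2 p q j f (spt p q v z)
            - (spt p q v z).2 j • pdV2 p q i f (spt p q v z)
            = (v i • eQ p q ξ j - v j • eQ p q ξ i) * F2 z := by
          have hi (k : Fin q) : (spt p q v z).2 k = z.2 * v k := rfl
          simp only [pdV2, hsingle, hi, sub_mul, smul_mul_assoc]
          match_scalars <;> field_simp
          ring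
        rw [hL, ← mul_assoc, eQ_mul_eQ_mul_sub ξ (by rintro rfl; omega), neg_mul]
      · simp
    simp only [sphericalDirac, hterm, Finset.sum_neg_distrib, neg_neg, ← Finset.sum_mul]
    rw [sum_lt_add (fun i => v i • eQ p q ξ i), smul_mul_assoc, ωCl]
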